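/- Let ω > 0, Λ > 0, λ > −Λ² and ξ > ω·√(λ + Λ²) be real numbers, and let 0 < r_p < r_a be the positive reals whose squares are the two roots of ω²u² − 2ξu + (λ + Λ²) = 0. Then the azimuthal increment of the gauged harmonic potential satisfies (1/π)·∫_{r_p}^{r_a} (Λ/(r²·√(2ξ − ω²r² − (λ + Λ²)/r²))) dr = Λ/(2·√(λ + Λ²)); in particular it is < 1/2 when λ > 0 and > 1/2 when λ < 0. -/

import Mathlib

open intervalIntegral

/-- **azimuthal increment of the gauged harmonic potential.** For the gauged
harmonic potential `ψ*(r) = (1/2)ω²r² + λ/(2r²)` with `ω > 0`, `λ > −Λ²`, `Λ > 0`, and an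
orbit of energy `ξ > ω√(λ + Λ²)` whose periastron and apoastron `0 < r_p < r_a` have
squares equal to the two roots of `ω²u² − 2ξu + (λ + Λ²) = 0`, the azimuthal increment is
`(1/π) ∫_{r_p}^{r_a} Λ/(r²√(2ξ − ω²r² − (λ + Λ²)/r²)) dr = Λ/(2√(λ + Λ²))`;
in particular it is `< 1/2` when `λ > 0` and `> 1/2` when `λ < 0`. -/
theorem stmt_15 (ω Λ lam ξ : ℝ) (hω : 0 < ω) (hΛ : 0 < Λ) (hlam : -Λ ^ 2 < lam)
    (hξ : ω * Real.sqrt (lam + Λ ^ 2) < ξ)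
    (rp ra : ℝ) (hrp : 0 < rp) (hlt : rp < ra)
    (hroot_p : ω ^ 2 * (rp ^ 2) ^ 2 - 2 * ξ * rp ^ 2 + (lam + Λ ^ 2) = 0)
    (hroot_a : ω ^ 2 * (ra ^ 2) ^ 2 - 2 * ξ * ra ^ 2 + (lam + Λ ^ 2) = 0) :
    (1 / Real.pi) * ∫ r in rp..ra,
        Λ / (r ^ 2 * Real.sqrt (2 * ξ - ω ^ 2 * r ^ 2 - (lam + Λ ^ 2) / r ^ 2))
      = Λ / (2 * Real.sqrt (lam + Λ ^ 2)) ∧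
    (0 < lam → Λ / (2 * Real.sqrt (lam + Λ ^ 2)) < 1 / 2) ∧
    (lam < 0 → 1 / 2 < Λ / (2 * Real.sqrt (lam + Λ ^ 2))) := by
  have hra : 0 < ra := hrp.trans hlt
  have hK : 0 < lam + Λ ^ 2 := by linarith
  have hAP : 0 < ra ^ 2 - rp ^ 2 := by nlinarith
  have h2ξ : 2 * ξ = ω ^ 2 * (ra ^ 2 + rp ^ 2) := by
    have : (ra ^ 2 - rp ^ 2) * (2 * ξ - ω ^ 2 * (ra ^ 2 + rp ^ 2)) = 0 := by
      linear_combination hroot_p - hroot_a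
    rcases mul_eq_zero.mp this with h | h
    · exact absurd h hAP.ne'
    · linarith
  have hKe : lam + Λ ^ 2 = (ω * rp * ra) ^ 2 := by
    linear_combination hroot_p + rp ^ 2 * h2ξ
  have hs : Real.sqrt (lam + Λ ^ 2) = ω * rp * ra := by
    rw [hKe]; exact Real.sqrt_sq (by positivity)
  refine ⟨?_, ?_, ?_⟩
  · rw [hs]
    let g : ℝ → ℝ := fun r => (2 * ra ^ 2 * rp ^ 2 / r ^ 2 - rp ^ 2 - ra ^ 2) / (ra ^ 2 - rp ^ 2)
    let F : ℝ → ℝ := fun r => -(Λ / (2 * (ω * rp * ra))) * Real.arcsin (g r)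
    have hcont : ContinuousOn F (Set.Icc rp ra) := by
      have hg : ContinuousOn g (Set.Icc rp ra) := by
        refine ContinuousOn.div_const (ContinuousOn.sub (ContinuousOn.sub
          (ContinuousOn.div (by fun_prop) (by fun_prop) ?_) (by fun_prop)) (by fun_prop)) _
        intro x hx
        have : 0 < x := hrp.trans_le hx.1
        positivity
      exact continuousOn_const.mul (Real.continuous_arcsin.comp_continuousOn hg)
    have hderiv : ∀ r ∈ Set.Ioo rp ra, HasDerivAt F
        (Λ / (r ^ 2 * Real.sqrt (2 * ξ - ω ^ 2 * r ^ 2 - (lam + Λ ^ 2) / r ^ 2))) r := by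
      intro r hr
      have hr0 : 0 < r := hrp.trans hr.1
      have h1 : 0 < r ^ 2 - rp ^ 2 := by nlinarith [hr.1]
      have h2 : 0 < ra ^ 2 - r ^ 2 := by nlinarith [hr.2]
      have hR : 2 * ξ - ω ^ 2 * r ^ 2 - (lam + Λ ^ 2) / r ^ 2
          = ω ^ 2 * ((r ^ 2 - rp ^ 2) * (ra ^ 2 - r ^ 2)) / r ^ 2 := by
        rw [h2ξ, hKe]; field_simp; ring
      have hRpos : 0 < 2 * ξ - ω ^ 2 * r ^ 2 - (lam + Λ ^ 2) / r ^ 2 := by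
        rw [hR]; positivity
      set R := 2 * ξ - ω ^ 2 * r ^ 2 - (lam + Λ ^ 2) / r ^ 2 with hRdef
      have hq : 1 - g r ^ 2 = (2 * rp * ra / (r * ω * (ra ^ 2 - rp ^ 2))) ^ 2 * R := by
        rw [hR]; simp only [g]; field_simp; ring
      have hqpos : 0 < 1 - g r ^ 2 := by rw [hq]; positivity
      have hsq : Real.sqrt (1 - g r ^ 2)
          = 2 * rp * ra / (r * ω * (ra ^ 2 - rp ^ 2)) * Real.sqrt R := by
        rw [hq, Real.sqrt_mul (by positivity), Real.sqrt_sq (by positivity)]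
      have hn1 : g r ≠ -1 := by intro h; rw [h] at hqpos; norm_num at hqpos
      have hn2 : g r ≠ 1 := by intro h; rw [h] at hqpos; norm_num at hqpos
      have hg : HasDerivAt g (-(4 * ra ^ 2 * rp ^ 2) / (r ^ 3 * (ra ^ 2 - rp ^ 2))) r := by
        have := ((((hasDerivAt_const r (2 * ra ^ 2 * rp ^ 2)).div (hasDerivAt_pow 2 r)
          (by positivity)).sub_const (rp ^ 2)).sub_const (ra ^ 2)).div_const (ra ^ 2 - rp ^ 2)
        refine this.congr_deriv ?_
        field_simp
        push_cast
        ring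
      have hF := ((Real.hasDerivAt_arcsin hn1 hn2).comp r hg).const_mul
        (-(Λ / (2 * (ω * rp * ra))))
      refine hF.congr_deriv ?_
      rw [hsq]
      have hsR : 0 < Real.sqrt R := Real.sqrt_pos.mpr hRpos
      field_simp
      try ring
    have hint : IntervalIntegrable (fun r => Λ / (r ^ 2 * Real.sqrt (2 * ξ - ω ^ 2 * r ^ 2
        - (lam + Λ ^ 2) / r ^ 2))) MeasureTheory.volume rp ra := by
      refine intervalIntegrable_deriv_of_nonneg (g := F) ?_ ?_ ?_
      · rwa [Set.uIcc_of_le hlt.le]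
      · rwa [min_eq_left hlt.le, max_eq_right hlt.le]
      · intro x _
        positivity
    rw [integral_eq_sub_of_hasDerivAt_of_le hlt.le hcont hderiv hint]
    have ga : g ra = -1 := by simp only [g]; field_simp; ring
    have gp : g rp = 1 := by simp only [g]; field_simp; ring
    simp only [F, ga, gp, Real.arcsin_neg, Real.arcsin_one]
    have := Real.pi_pos
    field_simp
    try ring
  · intro h
    have : Λ < Real.sqrt (lam + Λ ^ 2) := Real.lt_sqrt_of_sq_lt (by linarith)
    rw [div_lt_div_iff₀ (by linarith) (by norm_num)]
    linarith
  · intro h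
    have h1 : Real.sqrt (lam + Λ ^ 2) < Λ := (Real.sqrt_lt' hΛ).mpr (by linarith)
    have h0 := Real.sqrt_pos.mpr hK
    rw [div_lt_div_iff₀ (by norm_num) (by linarith)]
    linarith
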